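/- arXiv:1712.03428 — 3 statements merged into one kernel-verified Lean document; each statement's English description precedes it below -/
import Mathlib

section
/- Optimal batch size under the Hoeffding bound: let G > 0, L > 0, d ≥ 1 and δ ∈ (0,1), and define f : (0,∞) → ℝ by f(x) = ( G − L·√( (8/x)·ln((d+1)/δ) ) ) / x. Then f attains its unique global maximum over (0,∞) at x* = (18 L² / G²)·ln((d+1)/δ); in particular, for every x > 0 with x ≠ x*, f(x) < f(x*). -/
/-- Optimal batch size under the Hoeffding bound. -/
theorem stmt_13 (G L : ℝ) (hG : 0 < G) (hL : 0 < L)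
    (d : ℕ) (hd : 1 ≤ d) (δ : ℝ) (hδ : δ ∈ Set.Ioo (0 : ℝ) 1)
    (f : ℝ → ℝ)
    (hf : ∀ x, 0 < x →
      f x = (G - L * Real.sqrt (8 / x * Real.log ((d + 1) / δ))) / x)
    (xstar : ℝ)
    (hxstar : xstar = 18 * L ^ 2 / G ^ 2 * Real.log ((d + 1) / δ)) :
    ∀ x, 0 < x → x ≠ xstar → f x < f xstar := by
  intro x hx hne
  obtain ⟨h0, h1⟩ := hδ
  have hl : 0 < Real.log ((d + 1) / δ) := by
    apply Real.log_pos
    rw [lt_div_iff₀ h0]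
    have : (1 : ℝ) ≤ d := by exact_mod_cast hd
    linarith
  generalize Real.log ((d + 1) / δ) = l at *
  have hs : 0 < xstar := by rw [hxstar]; positivity
  rw [hf x hx, hf xstar hs]
  have e : Real.sqrt (8 / xstar * l) = 2 * G / (3 * L) := by
    rw [Real.sqrt_eq_iff_mul_self_eq (by positivity) (by positivity), hxstar]
    field_simp
    norm_num
  rw [e]
  have hu : Real.sqrt (8 / x * l) ^ 2 = 8 / x * l := Real.sq_sqrt (by positivity)
  have hu0 : 0 ≤ Real.sqrt (8 / x * l) := Real.sqrt_nonneg _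
  generalize Real.sqrt (8 / x * l) = u at *
  have hxu : u ^ 2 * x = 8 * l := by rw [hu]; field_simp
  have hv : L * u - 2 * G / 3 ≠ 0 := by
    intro h
    apply hne
    have hu' : u = 2 * G / (3 * L) := by field_simp; linarith
    rw [hu'] at hxu
    rw [hxstar]
    field_simp at hxu ⊢
    linarith
  have key : 0 < (L * u - 2 * G / 3) ^ 2 * (L * u + G / 3) := by positivity
  have i1 : 1 / x = u ^ 2 / (8 * l) := by rw [hu]; field_simp
  have a1 : (G - L * u) / x = (G - L * u) * (L * u) ^ 2 / (8 * l * L ^ 2) := by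
    rw [div_eq_mul_one_div, i1]; field_simp
  have a2 : (G - L * (2 * G / (3 * L))) / xstar = (4 * G ^ 3 / 27) / (8 * l * L ^ 2) := by
    rw [hxstar]; field_simp; ring
  rw [a1, a2]
  apply div_lt_div_of_pos_right _ (by positivity)
  nlinarith [key]
end

section
/- Optimal batch size under the Chebyshev bound: let G > 0, V > 0 and δ ∈ (0,1), and define f : (0,∞) → ℝ by f(x) = ( G − √( V/(δ·x) ) ) / x. Then f attains its unique global maximum over (0,∞) at x* = 9V/(4δG²); in particular, for every x > 0 with x ≠ x*, f(x) < f(x*). -/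
/-- Optimal batch size under the Chebyshev bound. -/
theorem stmt_14 (G V : ℝ) (hG : 0 < G) (hV : 0 < V)
    (δ : ℝ) (hδ : δ ∈ Set.Ioo (0 : ℝ) 1)
    (f : ℝ → ℝ)
    (hf : ∀ x, 0 < x → f x = (G - Real.sqrt (V / (δ * x))) / x)
    (xstar : ℝ) (hxstar : xstar = 9 * V / (4 * δ * G ^ 2)) :
    ∀ x, 0 < x → x ≠ xstar → f x < f xstar := by
  obtain ⟨hδ0, -⟩ := hδ
  intro x hx hne
  have hxs : 0 < xstar := by rw [hxstar]; positivity
  rw [hf x hx, hf xstar hxs]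
  have hs1 : Real.sqrt (V / (δ * xstar)) = 2 * G / 3 := by
    have h : V / (δ * xstar) = (2 * G / 3) ^ 2 := by
      rw [hxstar]; field_simp; norm_num
    rw [h, Real.sqrt_sq (by positivity)]
  rw [hs1]
  have hpos : 0 < V / (δ * x) := by positivity
  obtain ⟨s, hs⟩ : ∃ s, s = Real.sqrt (V / (δ * x)) := ⟨_, rfl⟩
  have hs0 : 0 < s := by rw [hs]; exact Real.sqrt_pos.mpr hpos
  have hsq : s ^ 2 = V / (δ * x) := by rw [hs]; exact Real.sq_sqrt hpos.le
  rw [← hs]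
  have hxe : x = V / (δ * s ^ 2) := by rw [hsq]; field_simp
  have hsne : s - 2 * G / 3 ≠ 0 := by
    intro h
    apply hne
    have h2 : s = 2 * G / 3 := by linarith
    rw [hxe, hxstar, h2]; field_simp; norm_num
  have key : 0 < (s - 2 * G / 3) ^ 2 * (s + G / 3) := by positivity
  have e1 : (G - s) / x = (G - s) * s ^ 2 * (δ / V) := by
    rw [hxe]; field_simp
  have e2 : (G - 2 * G / 3) / xstar = (4 * G ^ 3 / 27) * (δ / V) := by
    rw [hxstar]; field_simp; norm_num
  rw [e1, e2]
  apply mul_lt_mul_of_pos_right _ (by positivity)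
  nlinarith [key]
end

section
/- Optimal batch size under the Bernstein bound: let G > 0, a > 0 and b > 0, and define f : (0,∞) → ℝ by f(x) = ( G − √(b/x) − a/x ) / x. Then f attains its unique global maximum over (0,∞) at x* = ( 9b + 16aG + 3·√(9b² + 32abG) ) / (8G²); in particular, for every x > 0 with x ≠ x*, f(x) < f(x*). -/
/-- Optimal batch size under the Bernstein bound. -/
theorem stmt_15 (G a b : ℝ) (hG : 0 < G) (ha : 0 < a) (hb : 0 < b)
    (f : ℝ → ℝ)
    (hf : ∀ x, 0 < x → f x = (G - Real.sqrt (b / x) - a / x) / x)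
    (xstar : ℝ)
    (hxstar : xstar =
      (9 * b + 16 * a * G + 3 * Real.sqrt (9 * b ^ 2 + 32 * a * b * G)) /
        (8 * G ^ 2)) :
    ∀ x, 0 < x → x ≠ xstar → f x < f xstar := by
  intro x hx hne
  obtain ⟨s, hs, rfl⟩ : ∃ s : ℝ, 0 < s ∧ b = s ^ 2 :=
    ⟨Real.sqrt b, Real.sqrt_pos.2 hb, (Real.sq_sqrt hb.le).symm⟩
  have key : ∀ u : ℝ, 0 < u →
      f ((u ^ 2)⁻¹) = G * u ^ 2 - s * u ^ 3 - a * u ^ 4 := by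
    intro u hu
    have h1 : Real.sqrt (s ^ 2 / (u ^ 2)⁻¹) = s * u := by
      rw [div_inv_eq_mul, ← mul_pow, Real.sqrt_sq (by positivity)]
    rw [hf _ (by positivity), h1, div_inv_eq_mul, div_inv_eq_mul]
    ring
  obtain ⟨u, hu, rfl⟩ : ∃ u : ℝ, 0 < u ∧ x = (u ^ 2)⁻¹ := by
    refine ⟨(Real.sqrt x)⁻¹, inv_pos.2 (Real.sqrt_pos.2 hx), ?_⟩
    rw [inv_pow, inv_inv, Real.sq_sqrt hx.le]
  obtain ⟨R, hR, hR2⟩ : ∃ R : ℝ, 0 < R ∧ R ^ 2 = 9 * s ^ 2 + 32 * a * G :=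
    ⟨Real.sqrt (9 * s ^ 2 + 32 * a * G), Real.sqrt_pos.2 (by positivity),
      Real.sq_sqrt (by positivity)⟩
  have hsR : Real.sqrt (9 * (s ^ 2) ^ 2 + 32 * a * s ^ 2 * G) = s * R := by
    rw [← Real.sqrt_sq (by positivity : 0 ≤ s * R)]
    congr 1
    rw [mul_pow, hR2]; ring
  obtain ⟨v, hv⟩ : ∃ v : ℝ, v = 4 * G / (3 * s + R) := ⟨_, rfl⟩
  have hv0 : 0 < v := by rw [hv]; positivity
  have hxv : xstar = (v ^ 2)⁻¹ := by
    rw [hxstar, hsR, hv, div_pow, inv_div, div_eq_div_iff (by positivity) (by positivity)]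
    linear_combination (-8 * G ^ 2) * hR2
  have hcrit : 2 * G = 4 * a * v ^ 2 + 3 * s * v := by
    rw [hv]
    field_simp
    linear_combination 2 * hR2
  have huv : u - v ≠ 0 := by
    intro h
    apply hne
    rw [hxv, sub_eq_zero.1 h]
  rw [hxv, key u hu, key v hv0]
  have hpos : 0 < s * ((u - v) ^ 2 * (u + v / 2)) := by positivity
  have hnn : 0 ≤ a * (v ^ 2 - u ^ 2) ^ 2 := by positivity
  have hid : (G * v ^ 2 - s * v ^ 3 - a * v ^ 4) - (G * u ^ 2 - s * u ^ 3 - a * u ^ 4)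
      = a * (v ^ 2 - u ^ 2) ^ 2 + s * ((u - v) ^ 2 * (u + v / 2)) := by
    linear_combination ((v ^ 2 - u ^ 2) / 2) * hcrit
  linarith
end
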